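/- For all x, y ∈ ℝ² one has ‖σ(x) − σ(y)‖² ≤ 3|x−y|² + 2(|x|^p + |y|^p − 2(|x||y|)^{p/2−1}⟨x,y⟩). -/

import Mathlib

open Real

/-- Euclidean norm of a vector in ℝ². -/
noncomputable def nrm (x : Fin 2 → ℝ) : ℝ := Real.sqrt (x 0 ^ 2 + x 1 ^ 2)

/-- Euclidean inner product on ℝ². -/
noncomputable def inn (x y : Fin 2 → ℝ) : ℝ := x 0 * y 0 + x 1 * y 1

/-- The example diffusion coefficient σ(x). -/
noncomputable def sig (p : ℝ) (x : Fin 2 → ℝ) : Matrix (Fin 2) (Fin 2) ℝ :=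
  ![![x 0 / (1 + nrm x), x 1 / (1 + nrm x)],
    ![-((1 + nrm x ^ (p / 2 - 1)) * x 1), (1 + nrm x ^ (p / 2 - 1)) * x 0]]

/-- The example drift coefficient b(x) = -K₀(1+|x|^{p-2})x. -/
noncomputable def bdrift (p K₀ : ℝ) (x : Fin 2 → ℝ) : Fin 2 → ℝ :=
  fun i => -(K₀ * (1 + nrm x ^ (p - 2))) * x i

/-- Squared Hilbert–Schmidt (Frobenius) norm of a 2×2 real matrix. -/
noncomputable def hsSq (M : Matrix (Fin 2) (Fin 2) ℝ) : ℝ := ∑ i, ∑ j, M i j ^ 2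

lemma nrm_nonneg (x : Fin 2 → ℝ) : 0 ≤ nrm x := Real.sqrt_nonneg _

lemma nrm_sq (x : Fin 2 → ℝ) : nrm x ^ 2 = x 0 ^ 2 + x 1 ^ 2 :=
  Real.sq_sqrt (by positivity)

/-- Cauchy–Schwarz inequality on ℝ². -/
lemma inn_le_nrm_mul_nrm (x y : Fin 2 → ℝ) : inn x y ≤ nrm x * nrm y := by
  apply le_of_sq_le_sq _ (mul_nonneg (nrm_nonneg x) (nrm_nonneg y))
  rw [mul_pow, nrm_sq, nrm_sq, inn]
  nlinarith [sq_nonneg (x 0 * y 1 - x 1 * y 0)]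

lemma rpow_eq_sq_rpow_mul_sq {p r : ℝ} (hp : 2 < p) (hr : 0 ≤ r) :
    r ^ p = (r ^ (p / 2 - 1)) ^ 2 * r ^ 2 := by
  rw [← Real.rpow_mul_natCast hr, ← Real.rpow_natCast r 2,
    ← Real.rpow_add_of_nonneg hr (by push_cast; linarith) (by positivity)]
  congr 1
  push_cast
  ring

/-- The map `x ↦ x / (1 + |x|)` is 1-Lipschitz. -/
lemma sq_sub_div_one_add_nrm_le (x y : Fin 2 → ℝ) :
    (x 0 / (1 + nrm x) - y 0 / (1 + nrm y)) ^ 2 + (x 1 / (1 + nrm x) - y 1 / (1 + nrm y)) ^ 2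
      ≤ nrm (x - y) ^ 2 := by
  have hr := nrm_nonneg x
  have hs := nrm_nonneg y
  have hrsq := nrm_sq x
  have hssq := nrm_sq y
  have hcs := inn_le_nrm_mul_nrm x y
  rw [nrm_sq]
  simp only [inn, Pi.sub_apply, div_eq_mul_inv] at *
  generalize nrm x = r at *
  generalize nrm y = s at *
  have hu : (1 + r)⁻¹ * r = 1 - (1 + r)⁻¹ := by field_simp; ring
  have hv : (1 + s)⁻¹ * s = 1 - (1 + s)⁻¹ := by field_simp; ring
  have hu0 : 0 ≤ (1 + r)⁻¹ := by positivity
  have hv0 : 0 ≤ (1 + s)⁻¹ := by positivity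
  have hu1 : (1 + r)⁻¹ ≤ 1 := inv_le_one_of_one_le₀ (by linarith)
  have hv1 : (1 + s)⁻¹ ≤ 1 := inv_le_one_of_one_le₀ (by linarith)
  generalize (1 + r)⁻¹ = u at *
  generalize (1 + s)⁻¹ = v at *
  have huv0 : 0 ≤ u * v := mul_nonneg hu0 hv0
  have huv1 : u * v ≤ 1 := mul_le_one₀ hu1 hv0 hv1
  have hdiff : u * r - v * s = u * v * (r - s) := by linear_combination (1 - v) * hu - (1 - u) * hv
  calc (x 0 * u - y 0 * v) ^ 2 + (x 1 * u - y 1 * v) ^ 2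
      = (u * r - v * s) ^ 2 + u * v * (2 * (r * s - (x 0 * y 0 + x 1 * y 1))) := by
        linear_combination -u ^ 2 * hrsq - v ^ 2 * hssq
    _ = (u * v) ^ 2 * (r - s) ^ 2 + u * v * (2 * (r * s - (x 0 * y 0 + x 1 * y 1))) := by
        rw [hdiff]; ring
    _ ≤ 1 * (r - s) ^ 2 + 1 * (2 * (r * s - (x 0 * y 0 + x 1 * y 1))) := by
        gcongr
        exact pow_le_one₀ huv0 huv1
    _ = (x 0 - y 0) ^ 2 + (x 1 - y 1) ^ 2 := by linear_combination hrsq + hssq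

/-- ‖σ(x) − σ(y)‖² ≤ 3|x−y|² + 2(|x|^p + |y|^p − 2(|x||y|)^{p/2−1}⟨x,y⟩). -/
theorem stmt7 (p K₀ : ℝ) (hp2 : 2 < p) (hp4 : p < 4) (hK₀ : 4 ≤ K₀)
    (x y : Fin 2 → ℝ) :
    hsSq (sig p x - sig p y)
      ≤ 3 * nrm (x - y) ^ 2
        + 2 * (nrm x ^ p + nrm y ^ p - 2 * (nrm x * nrm y) ^ (p / 2 - 1) * inn x y) := by
  have hfirst := sq_sub_div_one_add_nrm_le x y
  have hxp := rpow_eq_sq_rpow_mul_sq hp2 (nrm_nonneg x)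
  have hyp := rpow_eq_sq_rpow_mul_sq hp2 (nrm_nonneg y)
  rw [Real.mul_rpow (nrm_nonneg x) (nrm_nonneg y), hxp, hyp]
  simp only [hsSq, Fin.sum_univ_two, Matrix.sub_apply]
  simp only [sig, inn, Matrix.cons_val_zero, Matrix.cons_val_one, nrm_sq, Pi.sub_apply] at hfirst ⊢
  generalize nrm x ^ (p / 2 - 1) = A at *
  generalize nrm y ^ (p / 2 - 1) = B at *
  nlinarith [sq_nonneg ((x 0 - y 0) - (A * x 0 - B * y 0)),
    sq_nonneg ((x 1 - y 1) - (A * x 1 - B * y 1))]
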